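/- Let p be a prime number dividing every coefficient f_0, f_1, …, f_n. Then the quotient R_f/pR_f is isomorphic, as an 𝔽_p-algebra, to 𝔽_p[x_1, …, x_{n−1}]/(x_i x_j : 1 ≤ i, j ≤ n−1), i.e., to the 𝔽_p-algebra obtained by adjoining to 𝔽_p an (n−1)-dimensional square-zero ideal. -/

import Mathlib

open Polynomial

noncomputable section

/-- The polynomial `f₀ Tⁿ + f₁ Tⁿ⁻¹ + ⋯ + fₙ` over `ℚ`. -/
def fpoly (n : ℕ) (f : ℕ → ℤ) : Polynomial ℚ :=
  ∑ i ∈ Finset.range (n + 1), Polynomial.C (f i : ℚ) * Polynomial.X ^ (n - i)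

/-- `Q_f = ℚ[T]/(f₀ Tⁿ + ⋯ + fₙ)`. -/
abbrev Qf (n : ℕ) (f : ℕ → ℤ) := AdjoinRoot (fpoly n f)

/-- `θ`, the image of `T` in `Q_f`. -/
def th (n : ℕ) (f : ℕ → ℤ) : Qf n f := AdjoinRoot.root _

/-- `ζ₀ = 1`, and `ζ_k = f₀ θ^k + f₁ θ^(k-1) + ⋯ + f_(k-1) θ` for `k ≥ 1`. -/
def zeta (n : ℕ) (f : ℕ → ℤ) (k : ℕ) : Qf n f :=
  if k = 0 then 1 else ∑ i ∈ Finset.range k, (f i : Qf n f) * th n f ^ (k - i)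

/-- `R_f`, the ℤ-span of `ζ₀, …, ζ_(n-1)` in `Q_f`. -/
def Rf (n : ℕ) (f : ℕ → ℤ) : Submodule ℤ (Qf n f) :=
  Submodule.span ℤ (Set.range fun k : Fin n => zeta n f k)

/-- `R_f` as a subring of `Q_f`: the subring generated by `ζ₀, …, ζ_(n-1)`
(it coincides with the ℤ-span of `ζ₀, …, ζ_(n-1)`). -/
def RfSubring (n : ℕ) (f : ℕ → ℤ) : Subring (Qf n f) :=
  Subring.closure (Set.range fun k : Fin n => zeta n f k)

/-- The 𝔽_p-algebra `𝔽_p[x₁, …, x_(n-1)]/(x_i x_j : 1 ≤ i, j ≤ n-1)`. -/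
abbrev SquareZeroAlg (p : ℕ) (n : ℕ) :=
  MvPolynomial (Fin (n - 1)) (ZMod p) ⧸
    Ideal.span (Set.range fun ij : Fin (n - 1) × Fin (n - 1) =>
      (MvPolynomial.X ij.1 * MvPolynomial.X ij.2 : MvPolynomial (Fin (n - 1)) (ZMod p)))

/-- The sums `f₀ t ^ k + f₁ t ^ (k - 1) + ⋯ + f_(k-1) t`, in Horner form. -/
def hornerSum {A : Type*} [CommRing A] (f : ℕ → ℤ) (t : A) : ℕ → A
  | 0 => 0
  | k + 1 => t * (hornerSum f t k + f k)

theorem hornerSum_eq_sum {A : Type*} [CommRing A] (f : ℕ → ℤ) (t : A) (k : ℕ) :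
    hornerSum f t k = ∑ i ∈ Finset.range k, (f i : A) * t ^ (k - i) := by
  induction k with
  | zero => simp [hornerSum]
  | succ k ih =>
    rw [hornerSum, ih, Finset.sum_range_succ, mul_add, Finset.mul_sum]
    congr 1
    · refine Finset.sum_congr rfl fun i hi => ?_
      rw [Nat.succ_sub (Finset.mem_range.1 hi).le, pow_succ]
      ring
    · simp [mul_comm]

theorem map_hornerSum {A B : Type*} [CommRing A] [CommRing B] (φ : A →+* B) (f : ℕ → ℤ) (t : A)
    (k : ℕ) : φ (hornerSum f t k) = hornerSum f (φ t) k := by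
  induction k with
  | zero => simp [hornerSum]
  | succ k ih => simp [hornerSum, ih]

theorem hornerSum_succ_mul {A : Type*} [CommRing A] (f : ℕ → ℤ) (t : A) (i j : ℕ) :
    hornerSum f t (i + 1) * hornerSum f t j =
      hornerSum f t i * hornerSum f t (j + 1) + f i * hornerSum f t (j + 1)
        - f j * hornerSum f t (i + 1) := by
  simp only [hornerSum]
  ring

theorem hornerSum_mul_mem {A : Type*} [CommRing A] {f : ℕ → ℤ} {t : A} {n : ℕ}
    {J : Submodule ℤ A} (hn : hornerSum f t n = -f n)
    (hJ : ∀ l ≤ n, ∀ m ≤ n, (f l : A) * hornerSum f t m ∈ J) :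
    ∀ i ≤ n, ∀ j ≤ n, hornerSum f t i * hornerSum f t j ∈ J := by
  intro i
  induction i with
  | zero => simp [hornerSum]
  | succ i ih =>
    intro hi j hj
    rcases hj.eq_or_lt with rfl | hj
    · rw [hn, mul_comm, neg_mul]
      exact J.neg_mem (hJ _ le_rfl _ hi)
    · rw [hornerSum_succ_mul]
      exact J.sub_mem (J.add_mem (ih (by omega) _ hj) (hJ _ (by omega) _ hj)) (hJ _ hj.le _ hi)

theorem degree_hornerSum {f : ℕ → ℤ} (hf : f 0 ≠ 0) (k : ℕ) :
    (hornerSum f (X : ℚ[X]) (k + 1)).degree = ((k + 1 : ℕ) : WithBot ℕ) := by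
  have key : ∀ k, (hornerSum f (X : ℚ[X]) k + (f k : ℚ[X])).degree = (k : WithBot ℕ) := by
    intro k
    have hC : ∀ j : ℕ, ((f j : ℤ) : ℚ[X]) = C (f j : ℚ) := fun j => by simp
    induction k with
    | zero =>
      rw [hornerSum, zero_add, hC]
      exact degree_C (by exact_mod_cast hf)
    | succ k ih =>
      have hd : (hornerSum f (X : ℚ[X]) (k + 1)).degree = ((k + 1 : ℕ) : WithBot ℕ) := by
        rw [hornerSum, degree_mul, degree_X, ih]
        push_cast
        ring
      rw [hC, degree_add_C (by rw [hd]; exact_mod_cast Nat.succ_pos k), hd]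
  rw [hornerSum, degree_mul, degree_X, key]
  push_cast
  ring

theorem fpoly_eq (n : ℕ) (f : ℕ → ℤ) : fpoly n f = hornerSum f X n + (f n : ℚ[X]) := by
  rw [fpoly, Finset.sum_range_succ, hornerSum_eq_sum]
  simp

theorem degree_fpoly {n : ℕ} (hn : n ≠ 0) {f : ℕ → ℤ} (hf : f 0 ≠ 0) :
    (fpoly n f).degree = n := by
  obtain ⟨k, rfl⟩ := Nat.exists_eq_succ_of_ne_zero hn
  have hC : ((f (k + 1) : ℤ) : ℚ[X]) = C (f (k + 1) : ℚ) := by simp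
  have hd := degree_hornerSum hf k
  rw [fpoly_eq, Nat.succ_eq_add_one, hC,
    degree_add_C (by rw [hd]; exact_mod_cast Nat.succ_pos k), hd]

theorem zeta_zero (n : ℕ) (f : ℕ → ℤ) : zeta n f 0 = 1 := by simp [zeta]

theorem zeta_succ (n : ℕ) (f : ℕ → ℤ) (k : ℕ) :
    zeta n f (k + 1) = hornerSum f (th n f) (k + 1) := by
  rw [hornerSum_eq_sum, zeta, if_neg k.succ_ne_zero]

theorem hornerSum_th_self (n : ℕ) (f : ℕ → ℤ) : hornerSum f (th n f) n = -(f n : Qf n f) := by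
  have h : AdjoinRoot.mk (fpoly n f) (hornerSum f X n + (f n : ℚ[X])) = 0 := by
    rw [← fpoly_eq, AdjoinRoot.mk_self]
  rw [map_add, map_hornerSum, AdjoinRoot.mk_X, map_intCast] at h
  exact eq_neg_of_add_eq_zero_left h

theorem zeta_mem_Rf {n : ℕ} {f : ℕ → ℤ} {k : ℕ} (hk : k < n) : zeta n f k ∈ Rf n f :=
  Submodule.subset_span ⟨⟨k, hk⟩, rfl⟩

theorem intCast_mem_Rf {n : ℕ} (hn : n ≠ 0) (f : ℕ → ℤ) (a : ℤ) : (a : Qf n f) ∈ Rf n f := by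
  have h := (Rf n f).smul_mem a (zeta_mem_Rf (Nat.pos_of_ne_zero hn))
  rwa [zeta_zero, zsmul_one] at h

theorem hornerSum_mem_Rf {n : ℕ} (hn : n ≠ 0) (f : ℕ → ℤ) {k : ℕ} (hk : k ≤ n) :
    hornerSum f (th n f) k ∈ Rf n f := by
  rcases hk.eq_or_lt with rfl | hk
  · rw [hornerSum_th_self]
    exact Submodule.neg_mem _ (intCast_mem_Rf hn f _)
  · cases k with
    | zero => simp [hornerSum]
    | succ k => exact zeta_succ n f k ▸ zeta_mem_Rf hk

/-- Products of two of `ζ₁, …, ζ_(n-1)` lie in `d R_f` if `d` divides all coefficients. -/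
theorem exists_zeta_mul_zeta_eq {n : ℕ} {f : ℕ → ℤ} {d : ℤ}
    (hdvd : ∀ i ≤ n, d ∣ f i) {i j : ℕ} (hi : i + 1 < n) (hj : j + 1 < n) :
    ∃ y ∈ Rf n f, (d : Qf n f) * y = zeta n f (i + 1) * zeta n f (j + 1) := by
  have h := hornerSum_mul_mem (J := (Rf n f).map (LinearMap.mulLeft ℤ (d : Qf n f)))
    (hornerSum_th_self n f) (fun l hl m hm => by
      obtain ⟨c, hc⟩ := hdvd l hl
      refine ⟨c • hornerSum f (th n f) m,
        Submodule.smul_mem _ _ (hornerSum_mem_Rf (by omega) f hm), ?_⟩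
      simp [hc, zsmul_eq_mul, mul_assoc]) (i + 1) hi.le (j + 1) hj.le
  rw [zeta_succ, zeta_succ]
  obtain ⟨y, hy, e⟩ := h
  exact ⟨y, hy, e⟩

theorem mul_mem_Rf {n : ℕ} {f : ℕ → ℤ} {x y : Qf n f} (hx : x ∈ Rf n f) (hy : y ∈ Rf n f) :
    x * y ∈ Rf n f := by
  have h : Rf n f * Rf n f ≤ Rf n f := by
    conv_lhs => rw [Rf, Submodule.span_mul_span]
    rw [Submodule.span_le]
    rintro _ ⟨_, ⟨⟨i, hi⟩, rfl⟩, _, ⟨⟨j, hj⟩, rfl⟩, rfl⟩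
    cases i with
    | zero => simpa [zeta_zero] using zeta_mem_Rf hj
    | succ i =>
      cases j with
      | zero => simpa [zeta_zero] using zeta_mem_Rf hi
      | succ j =>
        obtain ⟨y, hy, e⟩ := exists_zeta_mul_zeta_eq (f := f) (d := 1) (by simp) hi hj
        simpa [← e] using hy
  exact h (Submodule.mul_mem_mul hx hy)

theorem mem_RfSubring_iff {n : ℕ} (hn : n ≠ 0) {f : ℕ → ℤ} {x : Qf n f} :
    x ∈ RfSubring n f ↔ x ∈ Rf n f := by
  constructor
  · intro hx
    induction hx using Subring.closure_induction with
    | mem x hx => exact Submodule.subset_span hx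
    | zero => exact Submodule.zero_mem _
    | one => exact_mod_cast intCast_mem_Rf hn f 1
    | add x y _ _ hx hy => exact Submodule.add_mem _ hx hy
    | neg x _ hx => exact Submodule.neg_mem _ hx
    | mul x y _ _ hx hy => exact mul_mem_Rf hx hy
  · intro hx
    induction hx using Submodule.span_induction with
    | mem x hx => exact Subring.subset_closure hx
    | zero => exact Subring.zero_mem _
    | add x y _ _ hx hy => exact Subring.add_mem _ hx hy
    | smul a x _ hx => exact Subring.zsmul_mem _ hx a

theorem linearIndependent_zeta {n : ℕ} (hn : n ≠ 0) {f : ℕ → ℤ} (hf : f 0 ≠ 0) :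
    LinearIndependent ℚ fun k : Fin n => zeta n f k := by
  let S : Polynomial.Sequence ℚ :=
    { elems' := fun k => if k = 0 then 1 else hornerSum f X k
      degree_eq' := fun k => by
        cases k with
        | zero => simp
        | succ k => simpa using degree_hornerSum hf k }
  have hS : ∀ k, AdjoinRoot.mk (fpoly n f) (S k) = zeta n f k := by
    intro k
    change AdjoinRoot.mk (fpoly n f) (if k = 0 then 1 else hornerSum f X k) = _
    cases k with
    | zero => simp [zeta_zero]
    | succ k =>
      rw [if_neg k.succ_ne_zero, map_hornerSum, AdjoinRoot.mk_X, zeta_succ, th]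
  have hli : LinearIndependent ℚ fun k : Fin n => S k :=
    S.linearIndependent.comp _ Fin.val_injective
  rw [Fintype.linearIndependent_iff] at hli ⊢
  intro a ha
  refine hli a ?_
  have hmk : AdjoinRoot.mk (fpoly n f) (∑ k : Fin n, a k • S k) = 0 := by
    rw [← ha, map_sum]
    refine Finset.sum_congr rfl fun k _ => ?_
    rw [← hS, ← AdjoinRoot.smul_mk]
  rw [AdjoinRoot.mk_eq_zero] at hmk
  refine eq_zero_of_dvd_of_degree_lt hmk ?_
  rw [degree_fpoly hn hf, ← mem_degreeLT]
  refine Submodule.sum_mem _ fun k _ => Submodule.smul_mem _ _ ?_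
  rw [mem_degreeLT, S.degree_eq]
  exact_mod_cast k.2

theorem exists_mk_eq_of_squareZero {σ k : Type*} [Fintype σ] [CommRing k]
    (y : MvPolynomial σ k ⧸ Ideal.span (Set.range fun ij : σ × σ =>
      (MvPolynomial.X ij.1 * MvPolynomial.X ij.2 : MvPolynomial σ k))) :
    ∃ (a : k) (b : σ → k), y = Ideal.Quotient.mk _
      (MvPolynomial.C a + ∑ i, MvPolynomial.C (b i) * MvPolynomial.X i) := by
  classical
  obtain ⟨P, rfl⟩ := Ideal.Quotient.mk_surjective y
  induction P using MvPolynomial.induction_on with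
  | C a => exact ⟨a, 0, by simp⟩
  | add P Q hP hQ =>
    obtain ⟨a, b, h⟩ := hP
    obtain ⟨a', b', h'⟩ := hQ
    refine ⟨a + a', b + b', ?_⟩
    rw [map_add, h, h', ← map_add]
    congr 1
    simp only [Pi.add_apply, MvPolynomial.C_add, add_mul, Finset.sum_add_distrib]
    ring
  | mul_X P j hP =>
    obtain ⟨a, b, h⟩ := hP
    refine ⟨0, Pi.single j a, ?_⟩
    rw [map_mul, h, ← map_mul, Ideal.Quotient.eq]
    have hs : ∑ i, MvPolynomial.C ((Pi.single j a : σ → k) i) * (MvPolynomial.X i) =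
        (MvPolynomial.C a * MvPolynomial.X j : MvPolynomial σ k) := by
      rw [Finset.sum_eq_single j] <;> simp +contextual
    rw [hs, map_zero, zero_add, add_mul, add_sub_cancel_left, Finset.sum_mul]
    refine Ideal.sum_mem _ fun i _ => ?_
    rw [mul_assoc]
    exact Ideal.mul_mem_left _ _ (Ideal.subset_span ⟨(i, j), rfl⟩)

/-- A ring with a basis `1, w₁, …, w_m` over `k` such that `w_i w_j = 0` is isomorphic to
`k[x₁, …, x_m]/(x_i x_j)`. -/
theorem nonempty_ringEquiv_squareZero {σ k A : Type*} [Fintype σ] [CommRing k] [CommRing A]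
    (g : k →+* A) (w : σ → A) (hw : ∀ i j, w i * w j = 0)
    (hsurj : ∀ y, ∃ (a : k) (b : σ → k), g a + ∑ i, g (b i) * w i = y)
    (hinj : ∀ (a : k) (b : σ → k), g a + ∑ i, g (b i) * w i = 0 → a = 0 ∧ ∀ i, b i = 0) :
    Nonempty (A ≃+* (MvPolynomial σ k ⧸ Ideal.span (Set.range fun ij : σ × σ =>
      (MvPolynomial.X ij.1 * MvPolynomial.X ij.2 : MvPolynomial σ k)))) := by
  let φ := Ideal.Quotient.lift (Ideal.span (Set.range fun ij : σ × σ =>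
      (MvPolynomial.X ij.1 * MvPolynomial.X ij.2 : MvPolynomial σ k)))
    (MvPolynomial.eval₂Hom g w) (fun P hP => by
      refine (Ideal.span_le (I := RingHom.ker (MvPolynomial.eval₂Hom g w))).2 ?_ hP
      rintro _ ⟨ij, rfl⟩
      simp [RingHom.mem_ker, hw])
  have hφ : ∀ (a : k) (b : σ → k), φ (Ideal.Quotient.mk _
      (MvPolynomial.C a + ∑ i, MvPolynomial.C (b i) * MvPolynomial.X i)) =
      g a + ∑ i, g (b i) * w i := by
    intro a b
    refine (Ideal.Quotient.lift_mk _ _ _).trans ?_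
    simp
  refine ⟨(RingEquiv.ofBijective φ ⟨?_, ?_⟩).symm⟩
  · rw [injective_iff_map_eq_zero]
    intro y hy
    obtain ⟨a, b, rfl⟩ := exists_mk_eq_of_squareZero y
    rw [hφ] at hy
    obtain ⟨rfl, hb⟩ := hinj a b hy
    simp [hb]
  · intro y
    obtain ⟨a, b, rfl⟩ := hsurj y
    exact ⟨_, hφ a b⟩

theorem mem_RfSubring_iff_exists {m : ℕ} {f : ℕ → ℤ} {x : Qf (m + 1) f} :
    x ∈ RfSubring (m + 1) f ↔
      ∃ (a : ℤ) (b : Fin m → ℤ), a + ∑ i, b i * zeta (m + 1) f (i + 1) = x := by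
  rw [mem_RfSubring_iff m.succ_ne_zero, Rf, Submodule.mem_span_range_iff_exists_fun]
  simp only [Fin.sum_univ_succ, zsmul_eq_mul, Fin.val_zero, Fin.val_succ, zeta_zero, mul_one]
  constructor
  · rintro ⟨c, hc⟩
    exact ⟨c 0, fun i => c i.succ, hc⟩
  · rintro ⟨a, b, h⟩
    exact ⟨Fin.cons a b, by simpa using h⟩

theorem eq_of_add_sum_zeta_eq {m : ℕ} {f : ℕ → ℤ} (hf : f 0 ≠ 0) {a a' : ℤ} {b b' : Fin m → ℤ}
    (h : (a + ∑ i, b i * zeta (m + 1) f (i + 1) : Qf (m + 1) f) =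
      a' + ∑ i, b' i * zeta (m + 1) f (i + 1)) : a = a' ∧ ∀ i, b i = b' i := by
  have hli := linearIndependent_zeta m.succ_ne_zero hf
  rw [Fintype.linearIndependent_iff] at hli
  have key := hli (fun k => ((Fin.cons (a - a') (b - b') : Fin (m + 1) → ℤ) k : ℚ)) (by
    simp only [Int.cast_smul_eq_zsmul, zsmul_eq_mul]
    rw [Fin.sum_univ_succ]
    simp only [Fin.cons_zero, Fin.cons_succ, Fin.val_zero, Fin.val_succ, zeta_zero, Pi.sub_apply,
      Int.cast_sub, sub_mul, Finset.sum_sub_distrib]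
    linear_combination h)
  refine ⟨?_, fun i => ?_⟩
  · simpa [sub_eq_zero] using key 0
  · have := key i.succ
    rw [Fin.cons_succ, Int.cast_eq_zero] at this
    exact sub_eq_zero.1 this

theorem nonempty_quotient_ringEquiv {m : ℕ} {f : ℕ → ℤ} (hf : f 0 ≠ 0) {p : ℕ}
    (hdvd : ∀ i ≤ m + 1, (p : ℤ) ∣ f i) :
    Nonempty ((RfSubring (m + 1) f ⧸ Ideal.span {(p : RfSubring (m + 1) f)}) ≃+*
      SquareZeroAlg p (m + 1)) := by
  let I := Ideal.span {(p : RfSubring (m + 1) f)}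
  let z : Fin m → RfSubring (m + 1) f := fun i =>
    ⟨zeta (m + 1) f (i + 1), Subring.subset_closure ⟨i.succ, by simp⟩⟩
  have hpI : ((p : ℤ) : RfSubring (m + 1) f ⧸ I) = 0 := by
    have : Ideal.Quotient.mk I (p : RfSubring (m + 1) f) = 0 :=
      Ideal.Quotient.eq_zero_iff_mem.2 (Ideal.mem_span_singleton_self _)
    rw [map_natCast] at this
    exact_mod_cast this
  let g : ZMod p →+* RfSubring (m + 1) f ⧸ I :=
    (Ideal.Quotient.lift (Ideal.span {(p : ℤ)}) (Int.castRingHom _) (fun c hc => by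
      obtain ⟨d, rfl⟩ := Ideal.mem_span_singleton.1 hc
      rw [map_mul, eq_intCast, hpI, zero_mul])).comp
      (Int.quotientSpanNatEquivZMod p).symm.toRingHom
  have hg : ∀ (a : ℤ) (b : Fin m → ℤ), g a + ∑ i, g (b i) * Ideal.Quotient.mk I (z i) =
      Ideal.Quotient.mk I (a + ∑ i, b i * z i) := by
    intro a b
    simp only [map_add, map_sum, map_mul, map_intCast]
  refine nonempty_ringEquiv_squareZero (σ := Fin m) g (fun i => Ideal.Quotient.mk I (z i))
    ?_ ?_ ?_
  · intro i j
    obtain ⟨y, hy, e⟩ := exists_zeta_mul_zeta_eq hdvd (Nat.succ_lt_succ i.2) (Nat.succ_lt_succ j.2)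
    rw [← map_mul, Ideal.Quotient.eq_zero_iff_mem, Ideal.mem_span_singleton]
    refine ⟨⟨y, (mem_RfSubring_iff m.succ_ne_zero).2 hy⟩, Subtype.ext ?_⟩
    simpa [z] using e.symm
  · intro y
    obtain ⟨⟨x, hx⟩, rfl⟩ := Ideal.Quotient.mk_surjective y
    obtain ⟨a, b, e⟩ := mem_RfSubring_iff_exists.1 hx
    refine ⟨a, fun i => b i, ?_⟩
    rw [hg]
    congr 1
    exact Subtype.ext (by simpa [z] using e)
  · intro a b h
    obtain ⟨a, rfl⟩ := ZMod.intCast_surjective a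
    choose c hc using fun i => ZMod.intCast_surjective (b i)
    obtain rfl : (fun i => (c i : ZMod p)) = b := funext hc
    rw [hg, Ideal.Quotient.eq_zero_iff_mem, Ideal.mem_span_singleton] at h
    obtain ⟨⟨x, hx⟩, e⟩ := h
    obtain ⟨a', b', rfl⟩ := mem_RfSubring_iff_exists.1 hx
    have e' := congrArg Subtype.val e
    simp only [z, Subring.coe_add, Subring.coe_mul, Subring.coe_intCast, Subring.coe_natCast,
      AddSubmonoidClass.coe_finsetSum] at e'
    have key := eq_of_add_sum_zeta_eq hf (a := a) (b := c) (a' := p * a')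
      (b' := fun i => p * b' i) (by
        rw [e', mul_add, Finset.mul_sum]
        push_cast
        simp only [mul_assoc])
    simp only [ZMod.intCast_zmod_eq_zero_iff_dvd]
    exact ⟨⟨a', key.1⟩, fun i => ⟨b' i, key.2 i⟩⟩

/-- If a prime `p` divides every coefficient `f₀, …, f_n`, then the subring `R_f`
(which coincides with the ℤ-span `R_f`) has
`R_f / pR_f ≅ 𝔽_p[x₁, …, x_(n-1)]/(x_i x_j)` as rings (equivalently, as
`𝔽_p`-algebras). -/
theorem stmt18 (n : ℕ) (hn : 2 ≤ n) (f : ℕ → ℤ) (hf0 : f 0 ≠ 0)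
    (p : ℕ) (hp : p.Prime) (hdvd : ∀ i ≤ n, (p : ℤ) ∣ f i) :
    (∀ x : Qf n f, x ∈ RfSubring n f ↔ x ∈ Rf n f) ∧
    Nonempty
      ((RfSubring n f ⧸ Ideal.span {(p : RfSubring n f)}) ≃+* SquareZeroAlg p n) := by
  obtain ⟨m, rfl⟩ : ∃ m, n = m + 1 := ⟨n - 1, by omega⟩
  exact ⟨fun x => mem_RfSubring_iff m.succ_ne_zero, nonempty_quotient_ringEquiv hf0 hdvd⟩

end
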